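/- Let g be a good counter on a graph G with g(∅,∅) = 2 and g({v}) = 1 for all vertices v. Define a graph H on V(G) whose edges are the pairs {u,v} with g({u,v}) = 1. Then every component of H is a complete graph. -/

import Mathlib

open Finset
open scoped Classical

variable {V : Type*} [Fintype V]

/-- `fG G X Y` is the sum of `(-1)^|A|` over stable sets `A` of `G`
with `X ⊆ A` and `A ∩ Y = ∅`. -/
noncomputable def fG (G : SimpleGraph V) (X Y : Finset V) : ℤ :=
  ∑ A ∈ Finset.univ.filter (fun A : Finset V =>
      (∀ u ∈ A, ∀ v ∈ A, ¬ G.Adj u v) ∧ X ⊆ A ∧ Disjoint A Y),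
    (-1 : ℤ) ^ A.card

/-- `g` is a counter on `G` if `g = fG G` or `g = - fG G`. -/
def IsCounter (G : SimpleGraph V) (g : Finset V → Finset V → ℤ) : Prop :=
  (g = fun X Y => fG G X Y) ∨ (g = fun X Y => - fG G X Y)

/-- A counter is good if it satisfies the two boundedness conditions. -/
def IsGood (g : Finset V → Finset V → ℤ) : Prop :=
  ∀ X Y : Finset V, Disjoint X Y → (X ∪ Y).Nonempty →
    |g X Y| ≤ 1 ∧
    ∀ u v : V, u ∉ X ∪ Y → v ∉ X ∪ Y →
      |g (insert u X) Y - g (insert v X) Y| ≤ 1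

lemma fG_eq_insert_add (G : SimpleGraph V) (X Y : Finset V) (t : V) :
    fG G X Y = fG G (insert t X) Y + fG G X (insert t Y) := by
  unfold fG
  rw [← Finset.sum_filter_add_sum_filter_not _ (fun A : Finset V => t ∈ A),
    Finset.filter_filter, Finset.filter_filter]
  congr 1 <;> refine Finset.sum_congr (Finset.filter_congr fun A _ => ?_) fun _ _ => rfl
  · rw [Finset.insert_subset_iff]; tauto
  · rw [Finset.disjoint_insert_right]; tauto

lemma fG_eq_zero_of_adj (G : SimpleGraph V) {X : Finset V} (Y : Finset V) {a b : V}
    (ha : a ∈ X) (hb : b ∈ X) (hab : G.Adj a b) : fG G X Y = 0 := by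
  unfold fG
  refine Finset.sum_eq_zero fun A hA => ?_
  obtain ⟨hs, hX, -⟩ := (Finset.mem_filter.mp hA).2
  exact absurd hab (hs a (hX ha) b (hX hb))

lemma fG_eq_zero_of_isolated (G : SimpleGraph V) {X Y : Finset V} {w : V}
    (hwX : w ∉ X) (hwY : w ∉ Y) (hw : ∀ t, G.Adj w t → t ∈ Y) : fG G X Y = 0 := by
  have h : fG G (insert w X) Y = - fG G X (insert w Y) := by
    unfold fG
    rw [← Finset.sum_neg_distrib]
    refine Finset.sum_bij' (fun A _ => A.erase w) (fun A _ => insert w A) ?_ ?_ ?_ ?_ ?_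
    · intro A hA
      simp only [Finset.mem_filter, Finset.mem_univ, true_and, Finset.insert_subset_iff,
        Finset.disjoint_insert_right] at hA ⊢
      obtain ⟨hs, ⟨-, hX⟩, hY⟩ := hA
      refine ⟨fun a ha b hb => hs a (Finset.mem_of_mem_erase ha) b (Finset.mem_of_mem_erase hb),
        fun x hx => Finset.mem_erase.mpr ⟨fun h => hwX (h ▸ hx), hX hx⟩,
        Finset.notMem_erase w A, hY.mono_left (Finset.erase_subset w A)⟩
    · intro A hA
      simp only [Finset.mem_filter, Finset.mem_univ, true_and,
        Finset.disjoint_insert_right] at hA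
      obtain ⟨hs, hX, -, hY⟩ := hA
      have hA' : ∀ t ∈ A, ¬ G.Adj w t := fun t ht h => Finset.disjoint_left.mp hY ht (hw t h)
      simp only [Finset.mem_filter, Finset.mem_univ, true_and, Finset.disjoint_insert_left]
      refine ⟨?_, Finset.insert_subset_insert w hX, hwY, hY⟩
      simp only [Finset.forall_mem_insert]
      exact ⟨⟨G.irrefl, hA'⟩, fun a ha => ⟨fun h => hA' a ha h.symm, hs a ha⟩⟩
    · intro A hA
      exact Finset.insert_erase ((Finset.mem_filter.mp hA).2.2.1 (Finset.mem_insert_self w X))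
    · intro A hA
      exact Finset.erase_insert
        (Finset.disjoint_insert_right.mp (Finset.mem_filter.mp hA).2.2.2).1
    · intro A hA
      have hwA := (Finset.mem_filter.mp hA).2.2.1 (Finset.mem_insert_self w X)
      rw [← Finset.card_erase_add_one hwA, pow_succ]
      ring
  rw [fG_eq_insert_add G X Y w, h]
  ring

namespace IsCounter

variable {G : SimpleGraph V} {g : Finset V → Finset V → ℤ}

lemma eq_insert_add (hc : IsCounter G g) (X Y : Finset V) (t : V) :
    g X Y = g (insert t X) Y + g X (insert t Y) := by
  have := fG_eq_insert_add G X Y t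
  rcases hc with rfl | rfl <;> dsimp only <;> omega

lemma eq_zero_of_adj (hc : IsCounter G g) {X : Finset V} (Y : Finset V) {a b : V}
    (ha : a ∈ X) (hb : b ∈ X) (hab : G.Adj a b) : g X Y = 0 := by
  have := fG_eq_zero_of_adj G Y ha hb hab
  rcases hc with rfl | rfl <;> dsimp only <;> omega

lemma eq_zero_of_isolated (hc : IsCounter G g) {X Y : Finset V} {w : V}
    (hwX : w ∉ X) (hwY : w ∉ Y) (hw : ∀ t, G.Adj w t → t ∈ Y) : g X Y = 0 := by
  have := fG_eq_zero_of_isolated G hwX hwY hw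
  rcases hc with rfl | rfl <;> dsimp only <;> omega

/-- If these four values occurred at `(X, Y)`, then they would occur again at `(X, Y ∪ {t})` for
any neighbour `t` of `w` outside `Y`; such a neighbour always exists. -/
lemma not_exceptional (hc : IsCounter G g) (hg : IsGood g) {X Y : Finset V} {v w : V}
    (hXY : Disjoint X Y) (hne : (X ∪ Y).Nonempty) (hv : v ∉ X ∪ Y) (hw : w ∉ X ∪ Y) (hvw : v ≠ w)
    (h : g X Y = 1) (h_v : g (insert v X) Y = 0) (h_w : g (insert w X) Y = 1)
    (h_vw : g (insert w (insert v X)) Y = 1) : False := by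
  induction hn : Yᶜ.card using Nat.strong_induction_on generalizing Y with
  | _ n ih =>
  subst hn
  have hv' := hv
  have hw' := hw
  simp only [Finset.mem_union, not_or] at hv' hw'
  obtain ⟨t, hwt, htY⟩ : ∃ t, G.Adj w t ∧ t ∉ Y := by
    by_contra! hiso
    have := hc.eq_zero_of_isolated hw'.1 hw'.2 hiso
    omega
  have htw : t ≠ w := hwt.ne'
  have htX : t ∉ X := fun htX => by
    have := hc.eq_zero_of_adj (X := insert w X) Y (by simp) (by simp [htX]) hwt
    omega
  have htv : t ≠ v := by
    rintro rfl
    have := hc.eq_zero_of_adj (X := insert w (insert t X)) Y (by simp) (by simp) hwt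
    omega
  have z (Z Y' : Finset V) (hwZ : w ∈ Z) : g (insert t Z) Y' = 0 :=
    hc.eq_zero_of_adj Y' (by simp [hwZ]) (by simp) hwt
  have z_w := z (insert w X) Y (by simp)
  have z_vw := z (insert w (insert v X)) Y (by simp)
  have h_t : g (insert t X) Y = 0 := by
    have lower := (hg X Y hXY hne).2 w t hw (by simp [htX, htY])
    have upper := (hg X (insert w Y) (by simp [hXY, hw'.1]) (by simp)).2 v t
      (by simp [hv'.1, hv'.2, hvw]) (by simp [htX, htY, htw])
    have e₁ := hc.eq_insert_add (insert v X) Y w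
    have e₂ := hc.eq_insert_add (insert t X) Y w
    rw [Finset.insert_comm w t, z_w] at e₂
    rw [abs_le] at lower upper
    omega
  have h_vt : g (insert t (insert v X)) Y = 0 := by
    have lower := (hg (insert v X) Y (by simp [hXY, hv'.2]) (by simp)).2 w t
      (by simp [hw'.1, hw'.2, hvw.symm]) (by simp [htX, htY, htv])
    have upper := (hg (insert v X) (insert t (insert w Y))
      (by simp [hXY, hv'.2, hw'.1, hvw.symm, htX, htv]) (by simp)).1
    have e₁ := hc.eq_insert_add (insert v X) Y w
    have e₂ := hc.eq_insert_add (insert v X) (insert w Y) t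
    have e₃ := hc.eq_insert_add (insert t (insert v X)) Y w
    rw [Finset.insert_comm w t, z_vw] at e₃
    rw [abs_le] at lower upper
    omega
  refine ih (insert t Y)ᶜ.card ?_ (Y := insert t Y) (by simp [hXY, htX]) (by simp)
    (by simp [hv'.1, hv'.2, htv.symm]) (by simp [hw'.1, hw'.2, htw.symm]) ?_ ?_ ?_ ?_ rfl
  · exact Finset.card_lt_card
      (Finset.compl_ssubset_compl.mpr (Finset.ssubset_insert htY))
  · have := hc.eq_insert_add X Y t; omega
  · have := hc.eq_insert_add (insert v X) Y t; omega
  · have := hc.eq_insert_add (insert w X) Y t; omega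
  · have := hc.eq_insert_add (insert w (insert v X)) Y t; omega

lemma pair_eq_one_trans (hc : IsCounter G g) (hg : IsGood g) (h0 : g ∅ ∅ = 2)
    (h1 : ∀ v : V, g {v} ∅ = 1) {u v w : V} (huv : u ≠ v) (hvw : v ≠ w) (huw : u ≠ w)
    (h_uv : g {u, v} ∅ = 1) (h_vw : g {v, w} ∅ = 1) : g {u, w} ∅ = 1 := by
  have bound := (hg {u, w} ∅ (by simp) (by simp)).1
  have diff := (hg {u} ∅ (by simp) (by simp)).2 v w (by simp [huv.symm]) (by simp [huw.symm])
  have bound_uvw := (hg {u, v, w} ∅ (by simp) (by simp)).1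
  have bound_v := (hg {v} {u, w} (by simp [hvw, huv.symm]) (by simp)).1
  have h_u := h1 u
  have h_v := h1 v
  have h_w := h1 w
  have s₁ := hc.eq_insert_add ∅ ∅ u
  have s₂ := hc.eq_insert_add {v} ∅ u
  have s₃ := hc.eq_insert_add {w} ∅ u
  have s₄ := hc.eq_insert_add {v, w} ∅ u
  have s₅ := hc.eq_insert_add {v} {u} w
  simp only [insert_empty_eq] at s₁ s₂ s₃ s₄ s₅
  rw [Finset.pair_comm w v, Finset.pair_comm w u] at s₅
  rw [Finset.pair_comm v u, Finset.pair_comm w u] at diff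
  rw [abs_le] at bound diff bound_uvw bound_v
  by_contra hne
  have h_uw : g {u, w} ∅ = 0 := by omega
  obtain ha | ha : g {u, v, w} ∅ = 0 ∨ g {u, v, w} ∅ = 1 := by omega
  · refine hc.not_exceptional hg (X := ∅) (Y := {u}) (v := v) (w := w) (by simp) (by simp)
      (by simp [huv.symm]) (by simp [huw.symm]) hvw ?_ ?_ ?_ ?_
    · omega
    · rw [insert_empty_eq]; omega
    · rw [insert_empty_eq]; omega
    · rw [insert_empty_eq, Finset.pair_comm]; omega
  · refine hc.not_exceptional hg (X := {u}) (Y := ∅) (v := w) (w := v) (by simp) (by simp)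
      (by simp [huw.symm]) (by simp [huv.symm]) hvw.symm h_u ?_ ?_ ?_
    · rwa [Finset.pair_comm]
    · rwa [Finset.pair_comm]
    · rwa [Finset.pair_comm w u, Finset.insert_comm]

end IsCounter

theorem components_complete (G : SimpleGraph V) (g : Finset V → Finset V → ℤ)
    (hc : IsCounter G g) (hg : IsGood g)
    (h0 : g ∅ ∅ = 2) (h1 : ∀ v : V, g {v} ∅ = 1)
    (H : SimpleGraph V) (hH : ∀ u v : V, H.Adj u v ↔ u ≠ v ∧ g {u, v} ∅ = 1) :
    ∀ u v : V, H.Reachable u v → u ≠ v → H.Adj u v := by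
  intro u v huv
  rw [SimpleGraph.reachable_iff_reflTransGen] at huv
  induction huv with
  | refl => exact fun h => absurd rfl h
  | @tail v w _ hvw ih =>
    intro huw
    obtain rfl | huv := eq_or_ne u v
    · exact hvw
    · obtain ⟨hne, h_vw⟩ := (hH v w).mp hvw
      exact (hH u w).mpr
        ⟨huw, hc.pair_eq_one_trans hg h0 h1 huv hne huw ((hH u v).mp (ih huv)).2 h_vw⟩
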